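/- Assume it is not the case that q = 3 and dim_F W = 2. Then the first projection p_ℬ : S̃p_A^ℬ(W) → Sp(W) restricts to an isomorphism from the commutator subgroup [S̃p_A^ℬ(W), S̃p_A^ℬ(W)] onto Sp(W). -/

import Mathlib

set_option maxHeartbeats 1000000
set_option synthInstance.maxHeartbeats 1000000

noncomputable section

open scoped TensorProduct

/-! ## The base ring `𝒜`: the integral closure of `ℤ[1/p]` in a cyclotomic field -/

instance cycloAlgebra (p : ℕ) [NeZero p] (m : ℕ+) :
    Algebra (Localization.Away (p : ℤ)) (CyclotomicField m ℚ) :=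
  (Localization.awayLift (algebraMap ℤ (CyclotomicField m ℚ)) _
    (by
      rw [map_natCast]
      have h1 : IsUnit ((p : ℕ) : ℚ) :=
        isUnit_iff_ne_zero.mpr (Nat.cast_ne_zero.mpr (NeZero.ne p))
      have h2 := h1.map (algebraMap ℚ (CyclotomicField m ℚ))
      rwa [map_natCast] at h2)).toAlgebra

/-- The integral closure of `ℤ[1/p]` in the `m`-th cyclotomic field `ℚ(ζ_m)`. -/
def Aint (p : ℕ) [NeZero p] (m : ℕ+) :
    Subalgebra (Localization.Away (p : ℤ)) (CyclotomicField m ℚ) :=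
  integralClosure (Localization.Away (p : ℤ)) (CyclotomicField m ℚ)

/-- The ring `𝒜` associated to a finite field of characteristic `p` : the integral
closure of `ℤ[1/p]` in `ℚ(ζ_p)`. -/
def AA (p : ℕ+) : Type := ↥(Aint (p : ℕ) p)

instance (p : ℕ+) : CommRing (AA p) := inferInstanceAs (CommRing ↥(Aint (p : ℕ) p))

attribute [irreducible] AA

/-! ## The Heisenberg group -/

variable {F : Type*} [Field F] {W : Type*} [AddCommGroup W] [Module F W]

/-- The Heisenberg group attached to the bilinear form `β` : the set `W × F` with
multiplication `(w,t)(w',t') = (w+w', t+t'+½⟨w,w'⟩)`. -/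
@[ext]
structure Heis (β : W →ₗ[F] W →ₗ[F] F) : Type _ where
  w : W
  t : F

namespace Heis

variable {β : W →ₗ[F] W →ₗ[F] F}

instance : Mul (Heis β) :=
  ⟨fun a b => ⟨a.w + b.w, a.t + b.t + (2 : F)⁻¹ * β a.w b.w⟩⟩

instance : One (Heis β) := ⟨⟨0, 0⟩⟩

instance : Inv (Heis β) :=
  ⟨fun a => ⟨-a.w, -a.t + (2 : F)⁻¹ * β a.w a.w⟩⟩

@[simp] lemma mul_w (a b : Heis β) : (a * b).w = a.w + b.w := rfl
@[simp] lemma mul_t (a b : Heis β) :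
    (a * b).t = a.t + b.t + (2 : F)⁻¹ * β a.w b.w := rfl
@[simp] lemma one_w : (1 : Heis β).w = 0 := rfl
@[simp] lemma one_t : (1 : Heis β).t = 0 := rfl
@[simp] lemma inv_w (a : Heis β) : a⁻¹.w = -a.w := rfl
@[simp] lemma inv_t (a : Heis β) :
    a⁻¹.t = -a.t + (2 : F)⁻¹ * β a.w a.w := rfl

instance : Group (Heis β) where
  mul_assoc a b c := by
    ext
    · simp [add_assoc]
    · simp [map_add, LinearMap.add_apply]
      ring
  one_mul a := by ext <;> simp
  mul_one a := by ext <;> simp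
  inv_mul_cancel a := by
    ext
    · simp
    · simp [map_neg, LinearMap.neg_apply]

end Heis

/-! ## The induced representation `V_A^ℬ = ind_{A_H}^H(ψ_A^ℬ)` -/

/-- The compactly induced representation `ind_{A_H}^H ψ_A^ℬ`, realised as the
`ℬ`-submodule of functions `f : H → ℬ` with `f(ah) = ψ_A^ℬ(a) f(h)` for `a ∈ A_H`. -/
def IndV (β : W →ₗ[F] W →ₗ[F] F) (ℬ : Type*) [CommRing ℬ] (A : AddSubgroup W)
    (χ : Heis β → ℬˣ) : Submodule ℬ (Heis β → ℬ) where
  carrier := {f | ∀ a : Heis β, a.w ∈ A → ∀ h : Heis β, f (a * h) = (χ a : ℬ) * f h}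
  add_mem' := by
    intro f g hf hg a ha h
    simp only [Pi.add_apply, hf a ha h, hg a ha h, mul_add]
  zero_mem' := by intro a ha h; simp
  smul_mem' := by
    intro c f hf a ha h
    simp only [Pi.smul_apply, smul_eq_mul, hf a ha h]
    ring

/-- Right translation action of `h₀ ∈ H` on functions `H → ℬ`. -/
def hAct (β : W →ₗ[F] W →ₗ[F] F) (ℬ : Type*) [CommRing ℬ] (h₀ : Heis β) :
    (Heis β → ℬ) →ₗ[ℬ] (Heis β → ℬ) where
  toFun f := fun h => f (h * h₀)
  map_add' _ _ := rfl
  map_smul' _ _ := rfl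

lemma hAct_mem (β : W →ₗ[F] W →ₗ[F] F) (ℬ : Type*) [CommRing ℬ] (A : AddSubgroup W)
    (χ : Heis β → ℬˣ) (h₀ : Heis β) (f : Heis β → ℬ) (hf : f ∈ IndV β ℬ A χ) :
    hAct β ℬ h₀ f ∈ IndV β ℬ A χ := by
  intro a ha h
  simpa [hAct, mul_assoc] using hf a ha (h * h₀)

/-- The action `ρ` of the Heisenberg group on `V_A^ℬ`. -/
def hActV (β : W →ₗ[F] W →ₗ[F] F) (ℬ : Type*) [CommRing ℬ] (A : AddSubgroup W)
    (χ : Heis β → ℬˣ) (h₀ : Heis β) :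
    ↥(IndV β ℬ A χ) →ₗ[ℬ] ↥(IndV β ℬ A χ) :=
  (hAct β ℬ h₀).restrict fun f hf => hAct_mem β ℬ A χ h₀ f hf

/-! ## The symplectic group and its action on the Heisenberg group -/

/-- Action of a linear automorphism `g` on the Heisenberg group: `g·(w,t) = (gw,t)`. -/
def gHeis (β : W →ₗ[F] W →ₗ[F] F) (g : W ≃ₗ[F] W) : Heis β → Heis β :=
  fun h => ⟨g h.w, h.t⟩

/-- The symplectic group `Sp(W)` of the form `β`, as a subgroup of the linear
automorphism group of `W`. -/
def SpGrp (β : W →ₗ[F] W →ₗ[F] F) : Subgroup (W ≃ₗ[F] W) where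
  carrier := {g | ∀ u v : W, β (g u) (g v) = β u v}
  one_mem' := fun _ _ => rfl
  mul_mem' := by
    intro g g' hg hg' u v
    have h : ∀ x, (g * g') x = g (g' x) := fun _ => rfl
    rw [h, h, hg, hg']
  inv_mem' := by
    intro g hg u v
    have h1 := hg (g⁻¹ u) (g⁻¹ v)
    have h2 : ∀ x, g (g⁻¹ x) = x := fun x => g.apply_symm_apply x
    rw [h2, h2] at h1
    exact h1.symm

/-- The defining condition of the metaplectic group over `ℬ` : pairs `(g, M)` with
`g ∈ Sp(W)` and `M ∘ ρ(h) = ρ(g·h) ∘ M` for all `h ∈ H`. -/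
def MetaCond (β : W →ₗ[F] W →ₗ[F] F) (ℬ : Type*) [CommRing ℬ] (A : AddSubgroup W)
    (χ : Heis β → ℬˣ)
    (x : (W ≃ₗ[F] W) × (↥(IndV β ℬ A χ) ≃ₗ[ℬ] ↥(IndV β ℬ A χ))) : Prop :=
  (∀ u v : W, β (x.1 u) (x.1 v) = β u v) ∧
    ∀ (h₀ : Heis β) (f : ↥(IndV β ℬ A χ)),
      x.2 (hActV β ℬ A χ h₀ f) = hActV β ℬ A χ (gHeis β x.1 h₀) (x.2 f)

/-- The character `ψ_A^ℬ = φ ∘ ψ_A` of `A_H` with values in `ℬˣ`, obtained from a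
character with values in `𝒜ˣ` via the structure morphism `φ : 𝒜 → ℬ`. -/
def chB (p : ℕ+) (ℬ : Type*) [CommRing ℬ] [Algebra (AA p) ℬ]
    {β : W →ₗ[F] W →ₗ[F] F} (ψA : Heis β → (AA p)ˣ) : Heis β → ℬˣ :=
  fun h => Units.map (algebraMap (AA p) ℬ).toMonoidHom (ψA h)

/-- The character `ψ^ℬ = φ ∘ ψ` of `F` with values in `ℬˣ`. -/
def psB (p : ℕ+) (ℬ : Type*) [CommRing ℬ] [Algebra (AA p) ℬ]
    (ψ : F → (AA p)ˣ) : F → ℬˣ :=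
  fun t => Units.map (algebraMap (AA p) ℬ).toMonoidHom (ψ t)

/-- The metaplectic group over `ℬ`, as a subgroup of `Sp(W) × GL_ℬ(V_A^ℬ)`. -/
def MetaGrp (p : ℕ+) [Fact (Nat.Prime (p : ℕ))]
    {F : Type*} [Field F] {W : Type*} [AddCommGroup W] [Module F W]
    (β : W →ₗ[F] W →ₗ[F] F) (ℬ : Type*) [CommRing ℬ] [Algebra (AA p) ℬ]
    (A : AddSubgroup W) (ψA : Heis β → (AA p)ˣ) :
    Subgroup ((W ≃ₗ[F] W) ×
      (↥(IndV β ℬ A (chB p ℬ ψA)) ≃ₗ[ℬ] ↥(IndV β ℬ A (chB p ℬ ψA)))) where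
  carrier := {x | MetaCond β ℬ A (chB p ℬ ψA) x}
  one_mem' := ⟨fun _ _ => rfl, fun _ _ => rfl⟩
  mul_mem' := by
    intro x y hx hy
    refine ⟨fun u v => ?_, fun h₀ f => ?_⟩
    · have h : ∀ w, (x.1 * y.1) w = x.1 (y.1 w) := fun _ => rfl
      rw [Prod.fst_mul, h, h, hx.1, hy.1]
    · have h : ∀ f, (x.2 * y.2) f = x.2 (y.2 f) := fun _ => rfl
      rw [Prod.snd_mul, Prod.fst_mul, h, h, hy.2, hx.2]
      rfl
  inv_mem' := by
    intro x hx
    refine ⟨fun u v => ?_, fun h₀ f => ?_⟩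
    · have h1 := hx.1 (x.1⁻¹ u) (x.1⁻¹ v)
      have h2 : ∀ w, x.1 (x.1⁻¹ w) = w := fun w => x.1.apply_symm_apply w
      rw [h2, h2] at h1
      rw [Prod.fst_inv]
      exact h1.symm
    · have h1 := hx.2 (gHeis β x.1⁻¹ h₀) (x.2⁻¹ f)
      have h4 : gHeis β x.1 (gHeis β x.1⁻¹ h₀) = h₀ := by
        show (⟨x.1 (x.1⁻¹ h₀.w), h₀.t⟩ : Heis β) = h₀
        rw [show x.1 (x.1⁻¹ h₀.w) = h₀.w from x.1.apply_symm_apply _]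
      have h2 : x.2 (x.2⁻¹ f) = f := x.2.apply_symm_apply f
      rw [h4, h2] at h1
      have h5 := congrArg x.2.symm h1
      rw [x.2.symm_apply_apply] at h5
      rw [Prod.snd_inv, Prod.fst_inv]
      exact h5.symm

/-! ## Generation and perfectness of the symplectic group -/

section Symplectic

variable {β : W →ₗ[F] W →ₗ[F] F}

lemma form_swap (halt : ∀ v : W, β v v = 0) (u v : W) : β u v = -β v u := by
  have h := halt (u + v)
  simp only [map_add, LinearMap.add_apply, halt, zero_add, add_zero] at h
  linear_combination h

/-- The Eichler transformation attached to an orthogonal pair `x, y`. -/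
lemma exists_eichler (halt : ∀ v : W, β v v = 0) (x y : W) (hxy : β x y = 0) :
    ∃ g ∈ SpGrp β, ∀ w, g w = w + β x w • y + β y w • x := by
  have hyx : β y x = 0 := by rw [form_swap halt, hxy, neg_zero]
  let E : W → W →ₗ[F] W := fun z =>
    LinearMap.id + (β x).smulRight z + (β z).smulRight x
  have hE : ∀ z w, E z w = w + β x w • z + β z w • x := fun _ _ => rfl
  refine ⟨LinearEquiv.ofLinearMap (E y) (E (-y)) ?_ ?_, ?_, fun w => rfl⟩
  · ext w
    simp only [LinearMap.comp_apply, hE, LinearMap.id_apply, map_add, map_smul, map_neg,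
      LinearMap.neg_apply, halt, hxy, hyx, smul_eq_mul, smul_neg, neg_smul]
    simp
    abel
  · ext w
    simp only [LinearMap.comp_apply, hE, LinearMap.id_apply, map_add, map_smul, map_neg,
      LinearMap.neg_apply, halt, hxy, hyx, smul_eq_mul, smul_neg]
    simp
    abel
  · intro u v
    have h1 := form_swap halt u x
    have h2 := form_swap halt u y
    simp only [LinearEquiv.coe_ofLinearMap, hE, map_add, map_smul, LinearMap.add_apply,
      LinearMap.smul_apply, halt, hxy, hyx, smul_eq_mul, h1, h2]
    ring

lemma exists_transvection (halt : ∀ v : W, β v v = 0) (h2 : (2 : F) ≠ 0) (v : W) (c : F) :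
    ∃ g ∈ SpGrp β, ∀ w, g w = w + (c * β v w) • v := by
  obtain ⟨g, hg, h⟩ := exists_eichler halt v ((c / 2) • v) (by simp [halt])
  refine ⟨g, hg, fun w => ?_⟩
  rw [h, map_smul, LinearMap.smul_apply, smul_smul, add_assoc, ← add_smul, smul_eq_mul]
  congr 2
  field_simp
  ring

/-- Two non-orthogonal vectors are exchanged by a transvection along their difference. -/
lemma exists_transvection_map (halt : ∀ v : W, β v v = 0) (h2 : (2 : F) ≠ 0) {a b : W}
    (hab : β a b ≠ 0) :
    ∃ g ∈ SpGrp β, (∃ c : F, ∀ w, g w = w + (c * β (b - a) w) • (b - a)) ∧ g a = b := by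
  obtain ⟨g, hg, h⟩ := exists_transvection halt h2 (b - a) (-(β a b)⁻¹)
  refine ⟨g, hg, ⟨_, h⟩, ?_⟩
  rw [h, map_sub, LinearMap.sub_apply, halt, form_swap halt b a, sub_zero, neg_mul_neg,
    inv_mul_cancel₀ hab, one_smul]
  abel

/-- Two nonzero functionals have a common point of non-vanishing. -/
lemma exists_both_ne {V : Type*} [AddCommGroup V] [Module F V] (f g : V →ₗ[F] F)
    (S : Submodule F V) (hf : ∃ y ∈ S, f y ≠ 0) (hg : ∃ y ∈ S, g y ≠ 0) :
    ∃ y ∈ S, f y ≠ 0 ∧ g y ≠ 0 := by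
  obtain ⟨a, ha, hfa⟩ := hf
  obtain ⟨b, hb, hgb⟩ := hg
  by_cases hga : g a = 0
  · by_cases hfb : f b = 0
    · exact ⟨a + b, S.add_mem ha hb, by simpa [hfb] using hfa, by simpa [hga] using hgb⟩
    · exact ⟨b, hb, hfb, hgb⟩
  · exact ⟨a, ha, hfa, hga⟩

/-- The symplectic group is generated by transvections. -/
lemma SpGrp_le_of_transvections [FiniteDimensional F W] (halt : ∀ v : W, β v v = 0)
    (hnd : ∀ v : W, (∀ u : W, β v u = 0) → v = 0) (h2 : (2 : F) ≠ 0)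
    (K : Subgroup (W ≃ₗ[F] W))
    (hK : ∀ g : W ≃ₗ[F] W, (∃ (v : W) (c : F), ∀ w, g w = w + (c * β v w) • v) → g ∈ K) :
    SpGrp β ≤ K := by
  suffices H : ∀ (n : ℕ) (g : W ≃ₗ[F] W), g ∈ SpGrp β →
      Module.finrank F W ≤
        Module.finrank F (LinearMap.eqLocus (g : W →ₗ[F] W) LinearMap.id) + n → g ∈ K from
    fun g hg => H (Module.finrank F W) g hg (Nat.le_add_left _ _)
  intro n
  induction n with
  | zero =>
    intro g _ h
    have htop : LinearMap.eqLocus (g : W →ₗ[F] W) LinearMap.id = ⊤ :=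
      Submodule.eq_top_of_finrank_eq (le_antisymm (Submodule.finrank_le _) h)
    have h1 : g = 1 := by
      ext w
      have : w ∈ LinearMap.eqLocus (g : W →ₗ[F] W) LinearMap.id := htop ▸ Submodule.mem_top
      exact this
    exact h1 ▸ K.one_mem
  | succ n ih =>
    intro g hg hn
    by_cases hfix : ∀ v, g v = v
    · have h1 : g = 1 := LinearEquiv.ext hfix
      exact h1 ▸ K.one_mem
    push Not at hfix
    obtain ⟨v, hv⟩ := hfix
    have key : ∀ z, g z ≠ z → ∃ y ∈ LinearMap.range ((g : W →ₗ[F] W) - LinearMap.id),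
        β z y ≠ 0 := by
      intro z hz
      by_contra! hcon
      refine hz (sub_eq_zero.1 (hnd _ fun u => ?_))
      have h1 := hcon (g (g.symm u) - g.symm u) ⟨g.symm u, rfl⟩
      have h3 := hg z (g.symm u)
      simp only [LinearEquiv.apply_symm_apply, map_sub, LinearMap.sub_apply] at h1 h3 ⊢
      rw [h3, ← neg_eq_zero, neg_sub, h1]
    have orth : ∀ x w, g w = w → β (g x - x) w = 0 := fun x w hw => by
      have h := hg x w
      rw [hw] at h
      rw [map_sub, LinearMap.sub_apply, h, sub_self]
    obtain ⟨k, hkK, hkS, hkv, hkfix⟩ : ∃ k ∈ K, k ∈ SpGrp β ∧ k (g v) = v ∧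
        ∀ w, g w = w → k w = w := by
      by_cases h0 : β (g v) v = 0
      · obtain ⟨y, ⟨y', hy'⟩, hvy, hgvy⟩ := exists_both_ne (β v) (β (g v)) _ (key v hv)
          (key (g v) fun h => hv (g.injective h))
        replace hy' : g y' - y' = y := hy'
        obtain ⟨a, haS, ⟨ca, ha⟩, hax⟩ := exists_transvection_map halt h2
          (a := g v) (b := v + y) (by simpa [h0] using hgvy)
        obtain ⟨b, hbS, ⟨cb, hb⟩, hbx⟩ := exists_transvection_map halt h2
          (a := v + y) (b := v) (by
            rw [form_swap halt]
            simpa [halt] using hvy)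
        refine ⟨b * a, K.mul_mem (hK b ⟨_, _, hb⟩) (hK a ⟨_, _, ha⟩), mul_mem hbS haS, ?_, ?_⟩
        · rw [LinearEquiv.mul_apply, hax, hbx]
        · intro w hw
          have e1 : β (v + y - g v) w = 0 := by
            have h1 := orth v w hw
            have h3 := orth y' w hw
            rw [hy'] at h3
            simp only [map_sub, map_add, LinearMap.sub_apply, LinearMap.add_apply] at h1 ⊢
            linear_combination h3 - h1
          have e2 : β (v - (v + y)) w = 0 := by
            have h3 := orth y' w hw
            rw [hy'] at h3
            simpa using h3
          rw [LinearEquiv.mul_apply, ha, e1, mul_zero, zero_smul, add_zero, hb, e2, mul_zero,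
            zero_smul, add_zero]
      · obtain ⟨a, haS, ⟨ca, ha⟩, hax⟩ := exists_transvection_map halt h2 h0
        refine ⟨a, hK a ⟨_, _, ha⟩, haS, hax, fun w hw => ?_⟩
        have e1 : β (v - g v) w = 0 := by rw [← neg_sub, map_neg, LinearMap.neg_apply,
          orth v w hw, neg_zero]
        rw [ha, e1, mul_zero, zero_smul, add_zero]
    refine (K.mul_mem_cancel_left hkK).1 (ih (k * g) (mul_mem hkS hg) ?_)
    have hlt : LinearMap.eqLocus (g : W →ₗ[F] W) LinearMap.id <
        LinearMap.eqLocus ((k * g : W ≃ₗ[F] W) : W →ₗ[F] W) LinearMap.id := by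
      refine lt_of_le_of_ne (fun w hw => ?_) fun h => ?_
      · replace hw : g w = w := hw
        change k (g w) = w
        rw [hw, hkfix w hw]
      · have : v ∈ LinearMap.eqLocus (g : W →ₗ[F] W) LinearMap.id := h ▸ hkv
        exact hv this
    have := Submodule.finrank_lt_finrank_of_lt hlt
    omega

lemma transvection_mem_commutator_of_sq_ne_one (halt : ∀ v : W, β v v = 0)
    (hnd : ∀ v : W, (∀ u : W, β v u = 0) → v = 0) (h2 : (2 : F) ≠ 0) {l : F} (hl0 : l ≠ 0)
    (hl : l ^ 2 ≠ 1) {v : W} (hv : v ≠ 0) {c : F} {g : W ≃ₗ[F] W}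
    (hg : ∀ w, g w = w + (c * β v w) • v) : g ∈ ⁅SpGrp β, SpGrp β⁆ := by
  obtain ⟨x, hx⟩ : ∃ x, β v x ≠ 0 := by
    by_contra! h
    exact hv (hnd v h)
  obtain ⟨a, haS, -, ha⟩ := exists_transvection_map halt h2 hx
  obtain ⟨b, hbS, -, hb⟩ := exists_transvection_map halt h2 (a := x) (b := l • v)
    (by rw [form_swap halt]; simpa using ⟨hl0, hx⟩)
  have hs : (b * a) v = l • v := by rw [LinearEquiv.mul_apply, ha, hb]
  have hsS := mul_mem hbS haS
  generalize b * a = s at hs hsS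
  have hl' : l ^ 2 - 1 ≠ 0 := sub_ne_zero.2 hl
  obtain ⟨t, htS, ht⟩ := exists_transvection halt h2 v (c / (l ^ 2 - 1))
  have : g = s * t * s⁻¹ * t⁻¹ := by
    rw [eq_mul_inv_iff_mul_eq, eq_mul_inv_iff_mul_eq]
    ext w
    have h3 := hsS v w
    rw [hs, map_smul, LinearMap.smul_apply, smul_eq_mul] at h3
    simp only [LinearEquiv.mul_apply, hg, ht, map_add, map_smul, hs, halt, smul_eq_mul, mul_zero,
      add_zero]
    rw [← h3, add_assoc, ← add_smul, smul_smul]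
    congr 2
    field_simp
    ring
  rw [this]
  exact Subgroup.commutator_mem_commutator hsS htS

lemma transvection_mem_commutator_of_two_lt_finrank (halt : ∀ v : W, β v v = 0)
    (hnd : ∀ v : W, (∀ u : W, β v u = 0) → v = 0)
    (hdim : 2 < Module.finrank F W) {v : W} (hv : v ≠ 0) {c : F} {g : W ≃ₗ[F] W}
    (hg : ∀ w, g w = w + (c * β v w) • v) (h2 : (2 : F) ≠ 0) : g ∈ ⁅SpGrp β, SpGrp β⁆ := by
  obtain ⟨d, rfl⟩ : ∃ d, c = 2 * d := ⟨c / 2, by field_simp⟩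
  have hfind : ∀ z : W, z ≠ 0 → ∃ x, β z x = 1 := by
    intro z hz
    obtain ⟨x, hx⟩ : ∃ x, β z x ≠ 0 := by
      by_contra! h
      exact hz (hnd z h)
    exact ⟨(β z x)⁻¹ • x, by rw [map_smul, smul_eq_mul, inv_mul_cancel₀ hx]⟩
  obtain ⟨f, hf⟩ := hfind v hv
  have hf' : β f v = -1 := by rw [form_swap halt, hf]
  obtain ⟨z, hz⟩ : ∃ z, z ∉ Submodule.span F {v, f} := by
    by_contra! h
    have htop : Submodule.span F {v, f} = ⊤ := (Submodule.eq_top_iff'.2 h)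
    classical
    have hle := finrank_span_finset_le_card (R := F) ({v, f} : Finset W)
    rw [Finset.coe_insert, Finset.coe_singleton, Set.finrank, htop, finrank_top] at hle
    have := Finset.card_le_two (a := v) (b := f)
    omega
  set e := z - β z f • v - β v z • f with he
  have he0 : e ≠ 0 := by
    intro h
    apply hz
    have : z = β z f • v + β v z • f := by
      rw [he, sub_sub, sub_eq_zero] at h
      exact h
    rw [this]
    exact Submodule.mem_span_pair.2 ⟨_, _, rfl⟩
  have hve : β v e = 0 := by simp [he, halt, hf]
  have hev : β e v = 0 := by rw [form_swap halt, hve, neg_zero]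
  have hef : β e f = 0 := by simp [he, halt, hf]
  obtain ⟨y₀, hy₀⟩ := hfind e he0
  set y := y₀ - β y₀ f • v - β v y₀ • f with hy
  have hey : β e y = 1 := by simp [hy, hev, hef, hy₀]
  have hvy : β v y = 0 := by simp [hy, halt, hf]
  have hye : β y e = -1 := by rw [form_swap halt, hey]
  have hyv : β y v = 0 := by rw [form_swap halt, hvy, neg_zero]
  obtain ⟨s, hsS, hs⟩ := exists_eichler halt v (-d • y) (by simp [hvy])
  obtain ⟨t, htS, ht⟩ := exists_eichler halt v e hve
  have hsv : s v = v := by simp [hs, halt, hyv]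
  have hse : s e = e + d • v := by simp [hs, hve, hye]
  have : g = s * t * s⁻¹ * t⁻¹ := by
    rw [eq_mul_inv_iff_mul_eq, eq_mul_inv_iff_mul_eq]
    ext w
    have h3 := hsS v w
    have h4 := hsS e w
    rw [hsv] at h3
    rw [hse, map_add, LinearMap.add_apply, map_smul, LinearMap.smul_apply, smul_eq_mul, h3] at h4
    simp only [LinearEquiv.mul_apply, hg, ht, map_add, map_smul, hsv, hse, halt, hve, smul_eq_mul,
      mul_zero, add_zero, h3, smul_add]
    rw [← h4]
    module
  rw [this]
  exact Subgroup.commutator_mem_commutator hsS htS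

/-- The symplectic group is perfect, unless it is `Sp₂(𝔽₃)`. -/
lemma SpGrp_le_commutator [Fintype F] [FiniteDimensional F W] (halt : ∀ v : W, β v v = 0)
    (hnd : ∀ v : W, (∀ u : W, β v u = 0) → v = 0) (h2 : (2 : F) ≠ 0)
    (hexc : ¬(Fintype.card F = 3 ∧ Module.finrank F W = 2)) :
    SpGrp β ≤ ⁅SpGrp β, SpGrp β⁆ := by
  refine SpGrp_le_of_transvections halt hnd h2 _ ?_
  rintro g ⟨v, c, hg⟩
  by_cases hv : v = 0
  · have : g = 1 := by
      ext w
      simp [hg, hv]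
    exact this ▸ one_mem _
  by_cases hdim : 2 < Module.finrank F W
  · exact transvection_mem_commutator_of_two_lt_finrank halt hnd hdim hv hg h2
  by_cases hl : ∃ l : F, l ≠ 0 ∧ l ^ 2 ≠ 1
  · obtain ⟨l, hl0, hl⟩ := hl
    exact transvection_mem_commutator_of_sq_ne_one halt hnd h2 hl0 hl hv hg
  exfalso
  push Not at hl
  have h1 : (1 : F) ≠ -1 := fun h => h2 (by linear_combination h)
  have hcard : Fintype.card F = 3 := by
    classical
    have hu : (Finset.univ : Finset F) = {0, 1, -1} := by
      ext x
      simp only [Finset.mem_univ, Finset.mem_insert, Finset.mem_singleton, true_iff]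
      by_cases hx : x = 0
      · exact Or.inl hx
      · exact Or.inr (sq_eq_one_iff.1 (hl x hx))
    rw [← Finset.card_univ, hu, Finset.card_eq_three]
    exact ⟨0, 1, -1, zero_ne_one, (neg_ne_zero.2 one_ne_zero).symm, h1, rfl⟩
  have hne : Module.finrank F W ≠ 2 := fun h => hexc ⟨hcard, h⟩
  have hle : Module.finrank F W ≤ 1 := by omega
  refine hv (hnd v fun u => ?_)
  obtain ⟨x, hx⟩ := finrank_le_one_iff.1 hle
  obtain ⟨a, rfl⟩ := hx v
  obtain ⟨b, rfl⟩ := hx u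
  simp [halt]

end Symplectic

/-! ## The representation of the Heisenberg group over `ℬ` -/

/-- The properties of the characters `ψ^ℬ` and `ψ_A^ℬ` on which the study of `V_A^ℬ` rests;
`w₀` is a vector such that `ψ_A` is `a ↦ ψ(⟨a, w₀⟩)` on `A`. -/
structure IsHeisenbergDatum [Fintype F] (β : W →ₗ[F] W →ₗ[F] F) (ℬ : Type*) [CommRing ℬ]
    (A : AddSubgroup W) [Fintype A] (ψ : F → ℬˣ) (χ : Heis β → ℬˣ) (w₀ : W) : Prop where
  alt : ∀ v, β v v = 0
  two_ne : (2 : F) ≠ 0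
  char_add : ∀ x y, ψ (x + y) = ψ x * ψ y
  sum_field : ∀ c, c ≠ 0 → ∑ t, (ψ (c * t) : ℬ) = 0
  isUnit_card_field : IsUnit (Fintype.card F : ℬ)
  half_mem : ∀ a ∈ A, (2⁻¹ : F) • a ∈ A
  isotropic : ∀ v ∈ A, ∀ a ∈ A, ψ (β v a) = 1
  sum_subgroup : ∀ v, v ∉ A → ∑ a : A, (ψ (β v a) : ℬ) = 0
  isUnit_card_subgroup : IsUnit (Fintype.card A : ℬ)
  char_mul : ∀ a b : Heis β, a.w ∈ A → b.w ∈ A → χ (a * b) = χ a * χ b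
  char_center : ∀ t, χ ⟨0, t⟩ = ψ t
  shift : ∀ a ∈ A, χ ⟨a, 0⟩ * ψ (β w₀ a) = 1

namespace IsHeisenbergDatum

variable {β : W →ₗ[F] W →ₗ[F] F} {ℬ : Type*} [CommRing ℬ]
  {A : AddSubgroup W} {ψ : F → ℬˣ} {χ : Heis β → ℬˣ} {w₀ : W}

lemma hActV_apply (h : Heis β) (f : IndV β ℬ A χ) (x : Heis β) :
    (hActV β ℬ A χ h f : Heis β → ℬ) x = (f : Heis β → ℬ) (x * h) := rfl

lemma hActV_hActV (h h' : Heis β) (f : IndV β ℬ A χ) :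
    hActV β ℬ A χ h (hActV β ℬ A χ h' f) = hActV β ℬ A χ (h * h') f := by
  ext x
  simp only [hActV_apply, mul_assoc]

/-- The Gaussian average along the line `F v`, which intertwines a transvection along `v`. -/
lemma exists_gaussian [Fintype F] (ψ : F → ℬˣ) (v : W) (c : F) :
    ∃ G : IndV β ℬ A χ →ₗ[ℬ] IndV β ℬ A χ,
      ∀ f, G f = ∑ s : F, (ψ (-(s ^ 2 / (2 * c))) : ℬ) • hActV β ℬ A χ ⟨s • v, 0⟩ f :=
  ⟨∑ s : F, (ψ (-(s ^ 2 / (2 * c))) : ℬ) • hActV β ℬ A χ ⟨s • v, 0⟩, fun f => by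
    simp [LinearMap.sum_apply]⟩

variable [Fintype F] [Fintype A]

lemma char_zero (D : IsHeisenbergDatum β ℬ A ψ χ w₀) : ψ 0 = 1 := by
  have h := D.char_add 0 0
  rw [add_zero] at h
  exact left_eq_mul.1 h

lemma half_mul_two (D : IsHeisenbergDatum β ℬ A ψ χ w₀) (x : F) : 2⁻¹ * x + 2⁻¹ * x = x := by
  have := D.two_ne
  field_simp
  ring

lemma isotropic_mul (D : IsHeisenbergDatum β ℬ A ψ χ w₀) {v a : W}
    (hv : v ∈ A) (ha : a ∈ A) : ψ (2⁻¹ * β v a) = 1 := by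
  rw [← smul_eq_mul, ← map_smul]
  exact D.isotropic v hv _ (D.half_mem a ha)

lemma sum_subgroup_half (D : IsHeisenbergDatum β ℬ A ψ χ w₀) {v : W} (hv : v ∉ A) :
    ∑ a : A, (ψ (2⁻¹ * β v a) : ℬ) = 0 := by
  have h : (2⁻¹ : F) • v ∉ A := fun h => hv (by
    have := A.add_mem h h
    rwa [← add_smul, ← mul_one (2⁻¹ : F), D.half_mul_two, one_smul] at this)
  simpa using D.sum_subgroup _ h

lemma char_eq (D : IsHeisenbergDatum β ℬ A ψ χ w₀) {a : W} (ha : a ∈ A) (t : F) :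
    χ ⟨a, t⟩ = χ ⟨a, 0⟩ * ψ t := by
  rw [← D.char_center, ← D.char_mul _ _ ha A.zero_mem]
  congr 1
  ext <;> simp

lemma apply_center (D : IsHeisenbergDatum β ℬ A ψ χ w₀) (f : IndV β ℬ A χ) (w : W) (t : F) :
    (f : Heis β → ℬ) ⟨w, t⟩ = ψ t * (f : Heis β → ℬ) ⟨w, 0⟩ := by
  rw [← D.char_center, ← f.2 ⟨0, t⟩ A.zero_mem ⟨w, 0⟩]
  refine congrArg (f : Heis β → ℬ) (Heis.ext ?_ ?_)
  all_goals simp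

lemma hActV_eq (D : IsHeisenbergDatum β ℬ A ψ χ w₀) (w : W) (t : F) (f : IndV β ℬ A χ) :
    hActV β ℬ A χ ⟨w, t⟩ f = (ψ t : ℬ) • hActV β ℬ A χ ⟨w, 0⟩ f := by
  ext x
  simp only [hActV_apply, SetLike.val_smul, Pi.smul_apply, smul_eq_mul]
  rw [show x * ⟨w, t⟩ = (⟨x.w + w, x.t + t + 2⁻¹ * β x.w w⟩ : Heis β) from rfl,
    show x * ⟨w, 0⟩ = (⟨x.w + w, x.t + 0 + 2⁻¹ * β x.w w⟩ : Heis β) from rfl,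
    D.apply_center, D.apply_center f _ (x.t + 0 + _), ← mul_assoc, ← Units.val_mul, ← D.char_add]
  congr 3
  ring

lemma hActV_comp (D : IsHeisenbergDatum β ℬ A ψ χ w₀) (w w' : W) (t t' : F) (f : IndV β ℬ A χ) :
    hActV β ℬ A χ ⟨w, t⟩ (hActV β ℬ A χ ⟨w', t'⟩ f) =
      (ψ (t + t' + 2⁻¹ * β w w') : ℬ) • hActV β ℬ A χ ⟨w + w', 0⟩ f := by
  rw [hActV_hActV, ← D.hActV_eq]
  rfl

lemma gaussian_comp_neg (D : IsHeisenbergDatum β ℬ A ψ χ w₀) (v : W) {c : F} (hc : c ≠ 0)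
    {G G' : IndV β ℬ A χ →ₗ[ℬ] IndV β ℬ A χ}
    (hG : ∀ f, G f = ∑ s : F, (ψ (-(s ^ 2 / (2 * c))) : ℬ) • hActV β ℬ A χ ⟨s • v, 0⟩ f)
    (hG' : ∀ f, G' f = ∑ s : F, (ψ (-(s ^ 2 / (2 * -c))) : ℬ) • hActV β ℬ A χ ⟨s • v, 0⟩ f)
    (f : IndV β ℬ A χ) : G (G' f) = (Fintype.card F : ℬ) • f := by
  have h2 := D.two_ne
  simp only [hG', map_sum, hG, map_smul, D.hActV_comp]
  have e : ∀ r s : F, (ψ (-(s ^ 2 / (2 * c))) : ℬ) • (ψ (-(r ^ 2 / (2 * -c))) : ℬ) •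
      (ψ (0 + 0 + 2⁻¹ * r • (s • β v) v) : ℬ) • hActV β ℬ A χ ⟨s • v + r • v, 0⟩ f =
      (fun x => ((ψ (-(x ^ 2 / (2 * c))) : ℬ) * ψ (x / c * r)) • hActV β ℬ A χ ⟨x • v, 0⟩ f)
        (s + r) := by
    intro r s
    beta_reduce
    rw [smul_smul, smul_smul, ← add_smul, ← Units.val_mul, ← Units.val_mul, ← Units.val_mul,
      ← D.char_add, ← D.char_add, ← D.char_add]
    congr 3
    simp only [LinearMap.smul_apply, D.alt, smul_zero, mul_zero, add_zero]
    field_simp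
    ring
  simp_rw [Finset.smul_sum]
  rw [Finset.sum_comm]
  rw [Finset.sum_congr rfl fun r _ => (Finset.sum_congr rfl fun s _ => e r s).trans
    (Equiv.sum_comp (Equiv.addRight r) (fun x =>
      ((ψ (-(x ^ 2 / (2 * c))) : ℬ) * ψ (x / c * r)) • hActV β ℬ A χ ⟨x • v, 0⟩ f))]
  rw [Finset.sum_comm]
  simp_rw [← Finset.sum_smul, ← Finset.mul_sum]
  rw [Finset.sum_eq_single 0]
  · have h1 : (⟨(0 : F) • v, 0⟩ : Heis β) = 1 := by ext <;> simp
    have h3 : hActV β ℬ A χ 1 f = f := by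
      ext x
      rw [hActV_apply, mul_one]
    rw [h1, h3]
    simp [D.char_zero]
  · intro x _ hx
    rw [D.sum_field _ (div_ne_zero hx hc), mul_zero, zero_smul]
  · simp

lemma gaussian_intertwines (D : IsHeisenbergDatum β ℬ A ψ χ w₀) (v : W) {c : F} (hc : c ≠ 0)
    {g : W ≃ₗ[F] W}
    (hg : ∀ w, g w = w + (c * β v w) • v) {G : IndV β ℬ A χ →ₗ[ℬ] IndV β ℬ A χ}
    (hG : ∀ f, G f = ∑ s : F, (ψ (-(s ^ 2 / (2 * c))) : ℬ) • hActV β ℬ A χ ⟨s • v, 0⟩ f)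
    (h : Heis β) (f : IndV β ℬ A χ) :
    G (hActV β ℬ A χ h f) = hActV β ℬ A χ (gHeis β g h) (G f) := by
  have h2 := D.two_ne
  obtain ⟨w, t⟩ := h
  simp only [hG, map_sum, map_smul, gHeis, D.hActV_comp, hg, smul_smul, ← Units.val_mul,
    ← D.char_add]
  rw [← Equiv.sum_comp (Equiv.addRight (c * β v w))]
  refine Finset.sum_congr rfl fun s _ => ?_
  have hsw : β w v = -β v w := form_swap D.alt w v
  simp only [Equiv.coe_addRight]
  congr 2
  · congr 1
    simp only [map_smul, map_add, LinearMap.smul_apply, LinearMap.add_apply, D.alt, smul_eq_mul,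
      mul_zero, add_zero, hsw]
    field_simp
    ring
  · congr 2
    rw [add_smul]
    abel

/-- Every transvection lifts to the metaplectic group. -/
lemma exists_lift_transvection (D : IsHeisenbergDatum β ℬ A ψ χ w₀) {g : W ≃ₗ[F] W} (v : W) (c : F)
    (hg : ∀ w, g w = w + (c * β v w) • v) :
    ∃ M : IndV β ℬ A χ ≃ₗ[ℬ] IndV β ℬ A χ, ∀ (h : Heis β) (f : IndV β ℬ A χ),
      M (hActV β ℬ A χ h f) = hActV β ℬ A χ (gHeis β g h) (M f) := by
  by_cases hc : c = 0
  · refine ⟨LinearEquiv.refl _ _, fun h f => ?_⟩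
    have : gHeis β g h = h := by
      simp [gHeis, hg, hc]
    rw [this]
    rfl
  obtain ⟨G, hG⟩ := exists_gaussian (A := A) (χ := χ) ψ v c
  obtain ⟨G', hG'⟩ := exists_gaussian (A := A) (χ := χ) ψ v (-c)
  obtain ⟨u, hu⟩ := D.isUnit_card_field
  have h1 := D.gaussian_comp_neg v hc hG hG'
  have h2 := D.gaussian_comp_neg v (neg_ne_zero.2 hc) hG' (by simpa using hG)
  refine ⟨LinearEquiv.ofLinearMap G (((u⁻¹ : ℬˣ) : ℬ) • G') ?_ ?_,
    D.gaussian_intertwines v hc hg hG⟩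
  · ext1 f
    simp [h1, ← hu, smul_smul]
  · ext1 f
    simp [h2, ← hu, smul_smul]

end IsHeisenbergDatum

namespace IsHeisenbergDatum

variable {β : W →ₗ[F] W →ₗ[F] F} {ℬ : Type*} [CommRing ℬ]
  {A : AddSubgroup W} {ψ : F → ℬˣ} {χ : Heis β → ℬˣ} {w₀ : W}
  [Fintype F] [Fintype A]

/-- The function supported on `A_H` and equal to `χ` there. -/
lemma exists_indicator (D : IsHeisenbergDatum β ℬ A ψ χ w₀) :
    ∃ φ : IndV β ℬ A χ, (∀ h : Heis β, h.w ∈ A → (φ : Heis β → ℬ) h = χ h) ∧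
      ∀ h : Heis β, h.w ∉ A → (φ : Heis β → ℬ) h = 0 := by
  classical
  refine ⟨⟨fun h => if h.w ∈ A then χ h else 0, fun a ha h => ?_⟩, fun h hh => if_pos hh,
    fun h hh => if_neg hh⟩
  by_cases hh : h.w ∈ A
  · have h1 : (a * h).w ∈ A := A.add_mem ha hh
    simp only [h1, hh, if_true, D.char_mul a h ha hh, Units.val_mul]
  · have h1 : (a * h).w ∉ A := fun h1 => hh ((A.add_mem_cancel_left ha).1 h1)
    simp only [h1, hh, if_false, mul_zero]

/-- Projection onto the `χ`-eigenspace of `A_H`. -/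
lemma sum_char_inv_smul (D : IsHeisenbergDatum β ℬ A ψ χ w₀) {φ : IndV β ℬ A χ}
    (hφ : ∀ h : Heis β, h.w ∈ A → (φ : Heis β → ℬ) h = χ h)
    (hφ' : ∀ h : Heis β, h.w ∉ A → (φ : Heis β → ℬ) h = 0) (f : IndV β ℬ A χ) :
    ∑ a : A, (((χ ⟨a, 0⟩)⁻¹ : ℬˣ) : ℬ) • hActV β ℬ A χ ⟨a, 0⟩ f =
      ((Fintype.card A : ℬ) * (f : Heis β → ℬ) 1) • φ := by
  ext h
  have e : ∀ a : A, (((χ ⟨a, 0⟩)⁻¹ : ℬˣ) : ℬ) * (f : Heis β → ℬ) (h * ⟨a, 0⟩) =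
      ψ (β h.w a) * (f : Heis β → ℬ) h := by
    intro a
    have h1 : h * ⟨a, 0⟩ = (⟨a, β h.w a⟩ : Heis β) * h := by
      ext
      · simp [add_comm]
      · have := D.half_mul_two (β h.w a)
        simp only [Heis.mul_t]
        rw [form_swap D.alt (a : W) h.w]
        linear_combination this
    rw [h1, f.2 _ a.2, D.char_eq a.2 (β h.w a), Units.val_mul, ← mul_assoc, ← mul_assoc,
      Units.inv_mul, one_mul]
  simp only [AddSubmonoidClass.coe_finsetSum, Finset.sum_apply, SetLike.val_smul, Pi.smul_apply,
    smul_eq_mul, hActV_apply, e, ← Finset.sum_mul]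
  by_cases hh : h.w ∈ A
  · have h1 := f.2 h hh 1
    rw [mul_one] at h1
    rw [hφ h hh, h1]
    simp only [D.isotropic h.w hh _ (Subtype.prop _), Units.val_one, Finset.sum_const,
      Finset.card_univ, nsmul_eq_mul, mul_one]
    ring
  · rw [hφ' h hh, D.sum_subgroup _ hh, zero_mul, mul_zero]

/-- Schur's lemma: the `H`-endomorphisms of `V_A^ℬ` are scalar. -/
lemma exists_eq_smul (D : IsHeisenbergDatum β ℬ A ψ χ w₀)
    (M : IndV β ℬ A χ →ₗ[ℬ] IndV β ℬ A χ)
    (hM : ∀ (h : Heis β) (f : IndV β ℬ A χ), M (hActV β ℬ A χ h f) = hActV β ℬ A χ h (M f)) :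
    ∃ l : ℬ, ∀ f, M f = l • f := by
  obtain ⟨φ, hφ, hφ'⟩ := D.exists_indicator
  have h1 : (φ : Heis β → ℬ) 1 = 1 := by
    rw [hφ 1 A.zero_mem, show (1 : Heis β) = ⟨0, 0⟩ from rfl, D.char_center, D.char_zero,
      Units.val_one]
  have key : ∀ f, (M f : Heis β → ℬ) 1 = (M φ : Heis β → ℬ) 1 * (f : Heis β → ℬ) 1 := by
    intro f
    have e1 := congrArg M (D.sum_char_inv_smul hφ hφ' f)
    simp only [map_sum, map_smul, hM] at e1
    rw [D.sum_char_inv_smul hφ hφ' (M f)] at e1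
    have e2 := congrFun (congrArg Subtype.val e1) 1
    simp only [SetLike.val_smul, Pi.smul_apply, smul_eq_mul, h1, mul_one, mul_assoc] at e2
    rw [D.isUnit_card_subgroup.mul_left_cancel e2, mul_comm]
  refine ⟨(M φ : Heis β → ℬ) 1, fun f => ?_⟩
  ext h
  have e1 := key (hActV β ℬ A χ h f)
  rw [hM, hActV_apply, hActV_apply, one_mul] at e1
  exact e1

/-- The coordinate function `u ↦ f((w₀,0)(u,0))` of `f`. -/
def coord (w₀ : W) (f : IndV β ℬ A χ) (u : W) : ℬ := (f : Heis β → ℬ) (⟨w₀, 0⟩ * ⟨u, 0⟩)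

lemma coord_add_left (D : IsHeisenbergDatum β ℬ A ψ χ w₀) (f : IndV β ℬ A χ) {a : W}
    (ha : a ∈ A) (u : W) : coord w₀ f (a + u) = ψ (2⁻¹ * β u a) * coord w₀ f u := by
  have h1 : (⟨w₀, 0⟩ * ⟨a + u, 0⟩ : Heis β) =
      ⟨a, β w₀ a + 2⁻¹ * β u a⟩ * (⟨w₀, 0⟩ * ⟨u, 0⟩) := by
    ext
    · simp only [Heis.mul_w]
      abel
    · have := D.half_mul_two (β w₀ a)
      simp only [Heis.mul_t, Heis.mul_w, map_add]
      rw [form_swap D.alt a w₀, form_swap D.alt a u]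
      linear_combination this
  rw [coord, h1, f.2 _ ha, D.char_eq ha, D.char_add, ← mul_assoc, D.shift a ha, one_mul]
  rfl

lemma coord_hActV (D : IsHeisenbergDatum β ℬ A ψ χ w₀) (f : IndV β ℬ A χ) (u x : W) :
    coord w₀ (hActV β ℬ A χ ⟨x, 0⟩ f) u = ψ (2⁻¹ * β u (u + x)) * coord w₀ f (u + x) := by
  rw [coord, hActV_apply, coord, ← D.char_center, ← f.2 ⟨0, _⟩ A.zero_mem]
  refine congrArg (f : Heis β → ℬ) (Heis.ext ?_ ?_)
  · simp [add_assoc]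
  · simp [D.alt]
    ring

/-- The sum of all `ρ(w, 0)` acts on coordinates as a multiple of `u ↦ -u`. -/
lemma coord_sum_hActV [Fintype W] (D : IsHeisenbergDatum β ℬ A ψ χ w₀) (f : IndV β ℬ A χ)
    (u : W) :
    coord w₀ (∑ x : W, hActV β ℬ A χ ⟨x, 0⟩ f) u = Fintype.card A * coord w₀ f (-u) := by
  classical
  have e0 : coord w₀ (∑ x : W, hActV β ℬ A χ ⟨x, 0⟩ f) u =
      ∑ x : W, coord w₀ (hActV β ℬ A χ ⟨x, 0⟩ f) u := by
    simp [coord]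
  have e1 : coord w₀ (∑ x : W, hActV β ℬ A χ ⟨x, 0⟩ f) u =
      ∑ x : W, ψ (2⁻¹ * β u x) * coord w₀ f x := by
    rw [e0]
    simp only [D.coord_hActV]
    exact Equiv.sum_comp (Equiv.addLeft u) (fun x => (ψ (2⁻¹ * β u x) : ℬ) * coord w₀ f x)
  have e2 : ∀ a : A, ∑ x : W, (ψ (2⁻¹ * β u x) : ℬ) * coord w₀ f x =
      ∑ x : W, (ψ (2⁻¹ * β u x) * coord w₀ f x) * (ψ (2⁻¹ * β (u + x) a) : ℬ) := by
    intro a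
    rw [← Equiv.sum_comp (Equiv.addLeft (a : W))]
    refine Finset.sum_congr rfl fun x _ => ?_
    simp only [Equiv.coe_addLeft]
    rw [D.coord_add_left f a.2, map_add, map_add, LinearMap.add_apply, mul_add, mul_add,
      D.char_add, D.char_add]
    push_cast
    ring
  have e3 : (Fintype.card A : ℬ) * ∑ x : W, ψ (2⁻¹ * β u x) * coord w₀ f x =
      Fintype.card A * (Fintype.card A * coord w₀ f (-u)) := by
    calc (Fintype.card A : ℬ) * ∑ x : W, ψ (2⁻¹ * β u x) * coord w₀ f x
        = ∑ a : A, ∑ x : W, ψ (2⁻¹ * β u x) * coord w₀ f x := by simp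
      _ = ∑ a : A, ∑ x : W, (ψ (2⁻¹ * β u x) * coord w₀ f x) * (ψ (2⁻¹ * β (u + x) a) : ℬ) :=
          Finset.sum_congr rfl fun a _ => e2 a
      _ = ∑ x : W, (ψ (2⁻¹ * β u x) * coord w₀ f x) *
            if u + x ∈ A then (Fintype.card A : ℬ) else 0 := by
          rw [Finset.sum_comm]
          refine Finset.sum_congr rfl fun x _ => ?_
          rw [← Finset.mul_sum]
          congr 1
          split_ifs with hx
          · simp only [D.isotropic_mul hx (Subtype.prop _)]
            simp
          · exact D.sum_subgroup_half hx
      _ = ∑ x : W, if x ∈ A then (Fintype.card A : ℬ) * coord w₀ f (-u) else 0 := by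
          rw [← Equiv.sum_comp (Equiv.subRight u)]
          refine Finset.sum_congr rfl fun x _ => ?_
          simp only [Equiv.subRight_apply, add_sub_cancel]
          split_ifs with hx
          · rw [sub_eq_add_neg, D.coord_add_left f hx, ← mul_assoc, ← Units.val_mul,
              ← D.char_add]
            simp [D.alt, D.char_zero, mul_comm]
          · rw [mul_zero]
      _ = Fintype.card A * (Fintype.card A * coord w₀ f (-u)) := by
          rw [← Finset.sum_filter, Finset.sum_const, nsmul_eq_mul]
          congr 2
          exact (Fintype.card_subtype _).symm
  rw [e1, D.isUnit_card_subgroup.mul_left_cancel e3]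

end IsHeisenbergDatum

namespace IsHeisenbergDatum

variable {β : W →ₗ[F] W →ₗ[F] F} {ℬ : Type*} [CommRing ℬ]
  {A : AddSubgroup W} {ψ : F → ℬˣ} {χ : Heis β → ℬˣ} {w₀ : W}

/-- The functions in `V_A^ℬ` whose coordinate function is even. -/
def evenPart (β : W →ₗ[F] W →ₗ[F] F) (ℬ : Type*) [CommRing ℬ] (A : AddSubgroup W)
    (χ : Heis β → ℬˣ) (w₀ : W) : Submodule ℬ (IndV β ℬ A χ) where
  carrier := {f | ∀ u, coord w₀ f (-u) = coord w₀ f u}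
  add_mem' hf hg u := congrArg₂ (· + ·) (hf u) (hg u)
  zero_mem' _ := rfl
  smul_mem' c _ hf u := congrArg (c * ·) (hf u)

/-- Evaluation of coordinates at a family of points. -/
def coordMap (A : AddSubgroup W) (χ : Heis β → ℬˣ) (w₀ : W) {ι : Type*} (r : ι → W) :
    IndV β ℬ A χ →ₗ[ℬ] (ι → ℬ) where
  toFun f i := coord w₀ f (r i)
  map_add' _ _ := rfl
  map_smul' _ _ := rfl

variable [Fintype F] [Fintype A]

lemma char_neg (D : IsHeisenbergDatum β ℬ A ψ χ w₀) (x : F) : ψ (-x) = (ψ x)⁻¹ := by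
  rw [eq_inv_iff_mul_eq_one, ← D.char_add, neg_add_cancel, D.char_zero]

lemma ext_coord (D : IsHeisenbergDatum β ℬ A ψ χ w₀) {f g : IndV β ℬ A χ}
    (h : ∀ u, coord w₀ f u = coord w₀ g u) : f = g := by
  ext ⟨w, t⟩
  have e : (⟨w, t⟩ : Heis β) = ⟨0, t - 2⁻¹ * β w₀ w⟩ * (⟨w₀, 0⟩ * ⟨w - w₀, 0⟩) := by
    ext <;> simp [D.alt]
  rw [e, f.2 _ A.zero_mem, g.2 _ A.zero_mem]
  exact congrArg _ (h _)

lemma exists_coord_eq (D : IsHeisenbergDatum β ℬ A ψ χ w₀) (Φ : W → ℬ)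
    (hΦ : ∀ a ∈ A, ∀ u, Φ (a + u) = ψ (2⁻¹ * β u a) * Φ u) :
    ∃ f : IndV β ℬ A χ, ∀ u, coord w₀ f u = Φ u := by
  refine ⟨⟨fun h => ψ (h.t - 2⁻¹ * β w₀ h.w) * Φ (h.w - w₀), ?_⟩, fun u => ?_⟩
  · rintro ⟨a, s⟩ ha ⟨w, t⟩
    replace ha : a ∈ A := ha
    have h1 : χ ⟨a, s⟩ = ψ (s - β w₀ a) := by
      rw [D.char_eq ha, sub_eq_add_neg, D.char_add, D.char_neg, mul_comm,
        eq_inv_of_mul_eq_one_left (D.shift a ha)]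
    have := D.half_mul_two (β w₀ a)
    simp only [Heis.mul_w, Heis.mul_t]
    rw [h1, add_sub_assoc a w w₀, hΦ a ha, ← mul_assoc, ← mul_assoc, ← Units.val_mul, ← Units.val_mul,
      ← D.char_add, ← D.char_add]
    congr 3
    simp only [map_add, map_sub, LinearMap.sub_apply]
    rw [form_swap D.alt a w]
    linear_combination -this
  · simp [coord, D.alt, D.char_zero]

lemma char_half_congr (D : IsHeisenbergDatum β ℬ A ψ χ w₀) {u r a : W} (hu : u - r ∈ A)
    (ha : a ∈ A) : ψ (2⁻¹ * β r a) = ψ (2⁻¹ * β u a) := by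
  rw [← mul_one (ψ (2⁻¹ * β r a)), ← D.isotropic_mul hu ha, ← D.char_add, map_sub,
    LinearMap.sub_apply, ← mul_add, add_sub_cancel]

/-- `V_A^ℬ` is free of rank `|W / A|`. -/
lemma nonempty_linearEquiv (D : IsHeisenbergDatum β ℬ A ψ χ w₀) :
    Nonempty (IndV β ℬ A χ ≃ₗ[ℬ] (W ⧸ A → ℬ)) := by
  refine ⟨LinearEquiv.ofBijective (coordMap A χ w₀ Quotient.out) ⟨fun f g hfg => ?_, fun c => ?_⟩⟩
  · refine D.ext_coord fun u => ?_
    have hu : u - (u : W ⧸ A).out ∈ A := by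
      rw [← QuotientAddGroup.eq_iff_sub_mem, QuotientAddGroup.out_eq']
    have := congrFun hfg (u : W ⧸ A)
    rw [← sub_add_cancel u (u : W ⧸ A).out, D.coord_add_left f hu, D.coord_add_left g hu]
    exact congrArg _ this
  · obtain ⟨f, hf⟩ := D.exists_coord_eq
      (fun u => ψ (2⁻¹ * β (u : W ⧸ A).out u) * c (u : W ⧸ A)) (fun a ha u => by
        have e : ((a + u : W) : W ⧸ A) = (u : W ⧸ A) := by
          rw [QuotientAddGroup.eq_iff_sub_mem, add_sub_cancel_right]
          exact ha
        have hu : u - (u : W ⧸ A).out ∈ A := by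
          rw [← QuotientAddGroup.eq_iff_sub_mem, QuotientAddGroup.out_eq']
        rw [e, ← mul_assoc, ← D.char_half_congr hu ha, map_add, mul_add, D.char_add,
          Units.val_mul])
    refine ⟨f, funext fun q => ?_⟩
    change coord w₀ f q.out = c q
    rw [hf, QuotientAddGroup.out_eq', D.alt, mul_zero, D.char_zero, Units.val_one, one_mul]

/-- The even part of `V_A^ℬ` is free, its rank being the number of orbits of `±1` in `W / A`. -/
lemma nonempty_evenPart_linearEquiv (D : IsHeisenbergDatum β ℬ A ψ χ w₀) :
    Nonempty (evenPart β ℬ A χ w₀ ≃ₗ[ℬ] (MulAction.orbitRel.Quotient ℤˣ (W ⧸ A) → ℬ)) := by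
  classical
  let o : W → MulAction.orbitRel.Quotient ℤˣ (W ⧸ A) := fun u => Quotient.mk'' (u : W ⧸ A)
  let r : MulAction.orbitRel.Quotient ℤˣ (W ⧸ A) → W := fun x => x.out.out
  have hor : ∀ x, o (r x) = x := fun x => by
    change Quotient.mk'' ((x.out.out : W) : W ⧸ A) = x
    rw [QuotientAddGroup.out_eq']
    exact Quotient.out_eq x
  have ho_neg : ∀ u, o (-u) = o u := fun u => Quotient.sound' ⟨-1, by simp⟩
  have ho_add : ∀ a ∈ A, ∀ u, o (a + u) = o u := fun a ha u => by
    have e : ((a + u : W) : W ⧸ A) = (u : W ⧸ A) := by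
      rw [QuotientAddGroup.eq_iff_sub_mem, add_sub_cancel_right]
      exact ha
    change Quotient.mk'' ((a + u : W) : W ⧸ A) = _
    rw [e]
  have hr : ∀ u, u - r (o u) ∈ A ∨ -u - r (o u) ∈ A := by
    intro u
    have h1 : (o u).out ∈ MulAction.orbit ℤˣ (u : W ⧸ A) :=
      Quotient.mk_out (s := MulAction.orbitRel ℤˣ (W ⧸ A)) (u : W ⧸ A)
    obtain ⟨e, he⟩ := h1
    have h2 : ((r (o u) : W) : W ⧸ A) = (o u).out := QuotientAddGroup.out_eq' _
    rcases Int.units_eq_one_or e with rfl | rfl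
    · left
      rw [← QuotientAddGroup.eq_iff_sub_mem, h2, ← he]
      simp
    · right
      rw [← QuotientAddGroup.eq_iff_sub_mem, h2, ← he]
      simp
  refine ⟨LinearEquiv.ofBijective ((coordMap A χ w₀ r).comp (evenPart β ℬ A χ w₀).subtype)
    ⟨fun f g hfg => Subtype.ext (D.ext_coord fun u => ?_), fun c => ?_⟩⟩
  · have h : coord w₀ (f : IndV β ℬ A χ) (r (o u)) = coord w₀ (g : IndV β ℬ A χ) (r (o u)) :=
      congrFun hfg (o u)
    rcases hr u with hu | hu
    · rw [← sub_add_cancel u (r (o u)), D.coord_add_left _ hu, D.coord_add_left _ hu, h]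
    · rw [← f.2 u, ← g.2 u, ← sub_add_cancel (-u) (r (o u)), D.coord_add_left _ hu,
        D.coord_add_left _ hu, h]
  · let Φ : W → ℬ := fun u =>
      (if u - r (o u) ∈ A then (ψ (2⁻¹ * β (r (o u)) u) : ℬ)
        else ψ (2⁻¹ * β (-r (o u)) u)) * c (o u)
    obtain ⟨f, hf⟩ := D.exists_coord_eq Φ (fun a ha u => by
      have e : a + u - r (o u) ∈ A ↔ u - r (o u) ∈ A := by
        rw [add_sub_assoc]
        exact A.add_mem_cancel_left ha
      simp only [Φ, ho_add a ha u, e]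
      split_ifs with hu
      · rw [← mul_assoc, ← D.char_half_congr hu ha, map_add, mul_add, D.char_add,
          Units.val_mul]
      · have hu' : u - -r (o u) ∈ A := by
          have := A.neg_mem ((hr u).resolve_left hu)
          rwa [neg_sub, sub_neg_eq_add, add_comm, ← sub_neg_eq_add] at this
        rw [← mul_assoc, ← D.char_half_congr hu' ha, map_add, mul_add, D.char_add,
          Units.val_mul])
    refine ⟨⟨f, fun u => ?_⟩, funext fun x => ?_⟩
    · rw [hf, hf]
      simp only [Φ, ho_neg]
      congr 1
      by_cases h1 : u - r (o u) ∈ A <;> by_cases h2 : -u - r (o u) ∈ A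
      · have hrA : r (o u) ∈ A := by
          have h3 := D.half_mem _ (A.neg_mem (A.add_mem h1 h2))
          have h4 : -(u - r (o u) + (-u - r (o u))) = (2 : F) • r (o u) := by
            rw [two_smul]
            abel
          rwa [h4, smul_smul, inv_mul_cancel₀ D.two_ne, one_smul] at h3
        have huA : u ∈ A := by simpa using A.add_mem h1 hrA
        rw [if_pos h1, if_pos h2, D.isotropic_mul hrA huA, D.isotropic_mul hrA (A.neg_mem huA)]
      · rw [if_pos h1, if_neg h2, map_neg, map_neg, LinearMap.neg_apply, neg_neg]
      · rw [if_neg h1, if_pos h2, map_neg, map_neg, LinearMap.neg_apply]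
      · exact absurd (hr u) (not_or.2 ⟨h1, h2⟩)
    · change coord w₀ f (r x) = c x
      rw [hf]
      simp [Φ, hor, D.alt, D.char_zero]

/-- `W / A` has no nonzero fixed point under `-1`, so twice the number of orbits is `|W / A| + 1`. -/
lemma two_mul_card_orbits (D : IsHeisenbergDatum β ℬ A ψ χ w₀) [Finite W] :
    2 * Nat.card (MulAction.orbitRel.Quotient ℤˣ (W ⧸ A)) = Nat.card (W ⧸ A) + 1 := by
  classical
  have := Fintype.ofFinite (W ⧸ A)
  have := Fintype.ofFinite (MulAction.orbitRel.Quotient ℤˣ (W ⧸ A))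
  have h := MulAction.sum_card_fixedBy_eq_card_orbits_mul_card_group ℤˣ (W ⧸ A)
  have h1 : Fintype.card (MulAction.fixedBy (W ⧸ A) (1 : ℤˣ)) = Fintype.card (W ⧸ A) := by
    rw [← Nat.card_eq_fintype_card, ← Nat.card_eq_fintype_card, MulAction.fixedBy_one_eq_univ]
    exact Nat.card_univ
  have h2 : Fintype.card (MulAction.fixedBy (W ⧸ A) (-1 : ℤˣ)) = 1 := by
    rw [Fintype.card_eq_one_iff]
    refine ⟨⟨0, by simp⟩, ?_⟩
    rintro ⟨q, hq⟩
    induction q using QuotientAddGroup.induction_on with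
    | H u =>
      refine Subtype.ext ?_
      have h3 : -(u : W ⧸ A) = u := by simpa using hq
      have h4 : -u - u ∈ A := by
        rw [← QuotientAddGroup.eq_iff_sub_mem]
        exact h3
      have h5 := A.neg_mem (D.half_mem _ h4)
      have h6 : -u - u = (-2 : F) • u := by
        rw [neg_smul, two_smul]
        abel
      rw [h6, smul_smul, mul_neg, inv_mul_cancel₀ D.two_ne, neg_smul, one_smul, neg_neg] at h5
      exact (QuotientAddGroup.eq_zero_iff u).2 h5
  rw [UnitsInt.univ, Finset.sum_pair (by decide), h1, h2] at h
  rw [Nat.card_eq_fintype_card, Nat.card_eq_fintype_card, h, Fintype.card_units_int, mul_comm]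

end IsHeisenbergDatum

/-- A homomorphism from a subgroup to a commutative monoid kills its commutators. -/
lemma map_eq_one_of_mem_commutator {G : Type*} [Group G] {K : Subgroup G} {N : Type*}
    [CommMonoid N] (d : K →* N) {x : G} (hx : x ∈ ⁅K, K⁆) (hxK : x ∈ K) : d ⟨x, hxK⟩ = 1 := by
  rw [← Subgroup.map_subtype_commutator, Subgroup.mem_map] at hx
  obtain ⟨y, hy, rfl⟩ := hx
  have h := Abelianization.commutator_subset_ker d.toHomUnits hy
  exact congrArg Units.val (MonoidHom.mem_ker.1 h)

/-- The determinant of a scalar endomorphism of a free module. -/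
lemma det_eq_pow_card {R V ι : Type*} [CommRing R] [AddCommGroup V] [Module R V] [Finite ι]
    (e : V ≃ₗ[R] (ι → R)) {M : V →ₗ[R] V} {l : R} (hM : ∀ f, M f = l • f) :
    LinearMap.det M = l ^ Nat.card ι := by
  have : Fintype ι := Fintype.ofFinite ι
  nontriviality R
  have : Module.Free R V := Module.Free.of_equiv e.symm
  have h : M = l • LinearMap.id := LinearMap.ext hM
  rw [h, LinearMap.det_smul, LinearMap.det_id, mul_one, e.finrank_eq, Module.finrank_pi,
    Nat.card_eq_fintype_card]

namespace IsHeisenbergDatum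

variable {β : W →ₗ[F] W →ₗ[F] F} {ℬ : Type*} [CommRing ℬ]
  {A : AddSubgroup W} {ψ : F → ℬˣ} {χ : Heis β → ℬˣ} {w₀ : W} [Fintype F] [Fintype A]

lemma mem_evenPart_iff [Fintype W] (D : IsHeisenbergDatum β ℬ A ψ χ w₀) (f : IndV β ℬ A χ) :
    f ∈ evenPart β ℬ A χ w₀ ↔
      ∑ x : W, hActV β ℬ A χ ⟨x, 0⟩ f = (Fintype.card A : ℬ) • f := by
  have h1 : ∀ u, coord w₀ ((Fintype.card A : ℬ) • f) u = Fintype.card A * coord w₀ f u :=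
    fun _ => rfl
  refine ⟨fun hf => D.ext_coord fun u => ?_, fun hf u => ?_⟩
  · rw [D.coord_sum_hActV, h1, hf u]
  · rw [← D.isUnit_card_subgroup.mul_right_inj, ← D.coord_sum_hActV, hf, h1]

/-- The even part of `V_A^ℬ` is stable under the metaplectic group. -/
lemma apply_mem_evenPart [Finite W] (D : IsHeisenbergDatum β ℬ A ψ χ w₀)
    {x : (W ≃ₗ[F] W) × (IndV β ℬ A χ ≃ₗ[ℬ] IndV β ℬ A χ)} (hx : MetaCond β ℬ A χ x)
    {f : IndV β ℬ A χ} (hf : f ∈ evenPart β ℬ A χ w₀) : x.2 f ∈ evenPart β ℬ A χ w₀ := by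
  have : Fintype W := Fintype.ofFinite W
  rw [D.mem_evenPart_iff] at hf ⊢
  rw [← map_smul, ← hf, map_sum]
  simp only [hx.2]
  exact (Equiv.sum_comp x.1.toEquiv fun y => hActV β ℬ A χ ⟨y, 0⟩ (x.2 f)).symm

end IsHeisenbergDatum

section Metaplectic

variable {p : ℕ+} [Fact (Nat.Prime (p : ℕ))] {β : W →ₗ[F] W →ₗ[F] F} {ℬ : Type*} [CommRing ℬ]
  [Algebra (AA p) ℬ] {A : AddSubgroup W} {ψA : Heis β → (AA p)ˣ} {ψ : F → ℬˣ} {w₀ : W}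

/-- The determinant on `V_A^ℬ`, as a character of the metaplectic group. -/
def metaDet (β : W →ₗ[F] W →ₗ[F] F) (ℬ : Type*) [CommRing ℬ] [Algebra (AA p) ℬ]
    (A : AddSubgroup W) (ψA : Heis β → (AA p)ˣ) : MetaGrp p β ℬ A ψA →* ℬ where
  toFun x := LinearMap.det (x.1.2 : IndV β ℬ A (chB p ℬ ψA) →ₗ[ℬ] IndV β ℬ A (chB p ℬ ψA))
  map_one' := LinearMap.det_id
  map_mul' _ _ := LinearMap.det_comp _ _

variable [Fintype F] [Fintype A]

/-- The action of the metaplectic group on the even part of `V_A^ℬ`. -/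
def metaEven [Finite W] (D : IsHeisenbergDatum β ℬ A ψ (chB p ℬ ψA) w₀) :
    MetaGrp p β ℬ A ψA →* Module.End ℬ (IsHeisenbergDatum.evenPart β ℬ A (chB p ℬ ψA) w₀) where
  toFun x := (x.1.2 : IndV β ℬ A (chB p ℬ ψA) →ₗ[ℬ] IndV β ℬ A (chB p ℬ ψA)).restrict
    fun _ hf => D.apply_mem_evenPart x.2 hf
  map_one' := rfl
  map_mul' _ _ := rfl

/-- An element of the derived metaplectic group lying over `1` is trivial. -/
lemma eq_one_of_mem_commutator [Finite W] (D : IsHeisenbergDatum β ℬ A ψ (chB p ℬ ψA) w₀)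
    {x : (W ≃ₗ[F] W) × (IndV β ℬ A (chB p ℬ ψA) ≃ₗ[ℬ] IndV β ℬ A (chB p ℬ ψA))}
    (hx : x ∈ ⁅MetaGrp p β ℬ A ψA, MetaGrp p β ℬ A ψA⁆) (h1 : x.1 = 1) : x = 1 := by
  have hxK : x ∈ MetaGrp p β ℬ A ψA := Subgroup.commutator_le_self _ hx
  obtain ⟨l, hl⟩ := D.exists_eq_smul (x.2 : _ →ₗ[ℬ] _) fun h f => by
    have := hxK.2 h f
    rw [h1] at this
    exact this
  obtain ⟨e⟩ := D.nonempty_linearEquiv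
  obtain ⟨e'⟩ := D.nonempty_evenPart_linearEquiv
  have hd : l ^ Nat.card (W ⧸ A) = 1 := by
    rw [← det_eq_pow_card e hl]
    exact map_eq_one_of_mem_commutator (metaDet β ℬ A ψA) hx hxK
  have hd' : l ^ Nat.card (MulAction.orbitRel.Quotient ℤˣ (W ⧸ A)) = 1 := by
    have hl' : ∀ f, metaEven D ⟨x, hxK⟩ f = l • f := fun f => Subtype.ext (hl f.1)
    rw [← det_eq_pow_card (V := IsHeisenbergDatum.evenPart β ℬ A (chB p ℬ ψA) w₀) e' hl']
    exact map_eq_one_of_mem_commutator (N := ℬ)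
      ((LinearMap.det (M := IsHeisenbergDatum.evenPart β ℬ A (chB p ℬ ψA) w₀)).comp (metaEven D))
      hx hxK
  have hl1 : l = 1 := by
    have h : l ^ (Nat.card (W ⧸ A) + 1) = 1 := by
      rw [← D.two_mul_card_orbits, mul_comm, pow_mul, hd', one_pow]
    rwa [pow_succ, hd, one_mul] at h
  refine Prod.ext h1 (LinearEquiv.ext fun f => ?_)
  exact (hl f).trans (by rw [hl1, one_smul]; rfl)

/-- The metaplectic group maps onto the symplectic group. -/
lemma map_fst_MetaGrp [FiniteDimensional F W] (D : IsHeisenbergDatum β ℬ A ψ (chB p ℬ ψA) w₀)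
    (hnd : ∀ v : W, (∀ u : W, β v u = 0) → v = 0) :
    (MetaGrp p β ℬ A ψA).map (MonoidHom.fst _ _) = SpGrp β := by
  refine le_antisymm ?_ (SpGrp_le_of_transvections D.alt hnd D.two_ne _ ?_)
  · rintro _ ⟨x, hx, rfl⟩
    exact hx.1
  · rintro g ⟨v, c, hg⟩
    obtain ⟨M, hM⟩ := D.exists_lift_transvection v c hg
    refine ⟨(g, M), ⟨fun u w => ?_, hM⟩, rfl⟩
    simp only [hg, map_add, map_smul, LinearMap.add_apply, LinearMap.smul_apply, smul_eq_mul,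
      D.alt, form_swap D.alt u v]
    ring

lemma bijOn_commutator [FiniteDimensional F W]
    (D : IsHeisenbergDatum β ℬ A ψ (chB p ℬ ψA) w₀)
    (hnd : ∀ v : W, (∀ u : W, β v u = 0) → v = 0)
    (hexc : ¬(Fintype.card F = 3 ∧ Module.finrank F W = 2)) :
    Set.BijOn (fun x => x.1)
      (↑⁅MetaGrp p β ℬ A ψA, MetaGrp p β ℬ A ψA⁆ :
        Set ((W ≃ₗ[F] W) ×
          (IndV β ℬ A (chB p ℬ ψA) ≃ₗ[ℬ] IndV β ℬ A (chB p ℬ ψA))))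
      (↑(SpGrp β) : Set (W ≃ₗ[F] W)) := by
  have : Finite W := Module.finite_of_finite F
  refine ⟨fun x hx => (Subgroup.commutator_le_self _ hx).1, fun x hx y hy hxy => ?_, ?_⟩
  · refine mul_inv_eq_one.1 (eq_one_of_mem_commutator D (mul_mem hx (inv_mem hy)) ?_)
    exact mul_inv_eq_one.2 hxy
  · intro g hg
    have h := SpGrp_le_commutator D.alt hnd D.two_ne hexc hg
    rw [← map_fst_MetaGrp D hnd, ← Subgroup.map_commutator] at h
    exact h

end Metaplectic

/-! ## Characters with values in `𝒜` -/

/-- `𝒜` is an integral domain. -/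
lemma isDomain_AA (p : ℕ+) : IsDomain (AA p) := by
  with_unfolding_all exact inferInstanceAs (IsDomain ↥(Aint (p : ℕ) p))

/-- `p` is invertible in `𝒜`. -/
lemma isUnit_natCast_AA (p : ℕ+) : IsUnit ((p : ℕ) : AA p) := by
  have h : IsUnit ((p : ℕ) : Aint (p : ℕ) p) := by
    have h1 := (IsLocalization.Away.algebraMap_isUnit (S := Localization.Away ((p : ℕ) : ℤ))
      ((p : ℕ) : ℤ)).map (algebraMap _ (Aint (p : ℕ) p))
    simpa using h1
  with_unfolding_all exact h

/-- A nontrivial character of a finite group has sum zero. -/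
lemma sum_eq_zero_of_ne_one {G R : Type*} [AddGroup G] [Fintype G] [CommRing R] [IsDomain R]
    (θ : G → Rˣ) (hθ : ∀ x y, θ (x + y) = θ x * θ y) {g : G} (hg : θ g ≠ 1) :
    ∑ x, (θ x : R) = 0 := by
  have h : (θ g : R) * ∑ x, (θ x : R) = ∑ x, (θ x : R) := by
    rw [Finset.mul_sum]
    simp only [← Units.val_mul, ← hθ]
    exact Equiv.sum_comp (Equiv.addLeft g) fun x => (θ x : R)
  have h' : ((θ g : R) - 1) * ∑ x, (θ x : R) = 0 := by rw [sub_mul, h, one_mul, sub_self]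
  refine (mul_eq_zero.1 h').resolve_left fun h0 => hg (Units.ext (sub_eq_zero.1 h0))

/-- A self-dual subgroup is isotropic, also for the halved form. -/
lemma char_half_eq_one {R : Type*} [Monoid R] {β : W →ₗ[F] W →ₗ[F] F} {ψ : F → R}
    {A : AddSubgroup W} (hA : ∀ v : W, (∀ a ∈ A, ψ (β v a) = 1) ↔ v ∈ A)
    (hhalf : ∀ a ∈ A, (2⁻¹ : F) • a ∈ A) {a b : W} (ha : a ∈ A) (hb : b ∈ A) :
    ψ (2⁻¹ * β a b) = 1 := by
  rw [← smul_eq_mul, ← map_smul]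
  exact (hA a).2 ha _ (hhalf b hb)

/-- A nontrivial character of `F` sums to zero on the nonzero multiples of a variable. -/
lemma sum_mul_eq_zero [Fintype F] {R : Type*} [CommRing R] [IsDomain R] {ψ : F → Rˣ}
    (hψ : ∀ x y : F, ψ (x + y) = ψ x * ψ y) (hψnt : ∃ x : F, ψ x ≠ 1) {c : F} (hc : c ≠ 0) :
    ∑ t, (ψ (c * t) : R) = 0 := by
  obtain ⟨x, hx⟩ := hψnt
  refine sum_eq_zero_of_ne_one (fun t => ψ (c * t)) (fun x y => by rw [mul_add, hψ])
    (g := c⁻¹ * x) ?_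
  rwa [mul_inv_cancel_left₀ hc]

/-- Every extension of `ψ` to `A_H` is given on `A` by pairing with a vector of `W`. -/
lemma exists_shift [Finite W] {R : Type*} [CommRing R] [IsDomain R]
    {β : W →ₗ[F] W →ₗ[F] F} (halt : ∀ v : W, β v v = 0)
    (hnd : ∀ v : W, (∀ u : W, β v u = 0) → v = 0) {ψ : F → Rˣ}
    (hψ : ∀ x y : F, ψ (x + y) = ψ x * ψ y) (hψnt : ∃ x : F, ψ x ≠ 1)
    (hcard : (Nat.card W : R) ≠ 0) {A : AddSubgroup W}
    (hA : ∀ v : W, (∀ a ∈ A, ψ (β v a) = 1) ↔ v ∈ A)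
    (hhalf : ∀ a ∈ A, (2⁻¹ : F) • a ∈ A) {χ : Heis β → Rˣ}
    (hχ : ∀ a b : Heis β, a.w ∈ A → b.w ∈ A → χ (a * b) = χ a * χ b)
    (hχext : ∀ t : F, χ ⟨0, t⟩ = ψ t) :
    ∃ w₀ : W, ∀ a ∈ A, χ ⟨a, 0⟩ * ψ (β w₀ a) = 1 := by
  classical
  have : Fintype W := Fintype.ofFinite W
  have hψ0 : ψ 0 = 1 := by
    have h := hψ 0 0
    rw [add_zero] at h
    exact left_eq_mul.1 h
  have hadd : ∀ w, ∀ a b : A, χ ⟨(a + b : A), 0⟩ * ψ (β w (a + b : A)) =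
      (χ ⟨a, 0⟩ * ψ (β w a)) * (χ ⟨b, 0⟩ * ψ (β w b)) := by
    intro w a b
    have e : (⟨a, 0⟩ * ⟨b, 0⟩ : Heis β) = ⟨0, 2⁻¹ * β (a : W) b⟩ * ⟨(a + b : A), 0⟩ := by
      ext <;> simp
    have h := hχ ⟨a, 0⟩ ⟨b, 0⟩ a.2 b.2
    rw [e, hχ _ _ A.zero_mem (a + b).2, hχext, char_half_eq_one hA hhalf a.2 b.2, one_mul] at h
    rw [h, AddSubgroup.coe_add, map_add, hψ]
    exact mul_mul_mul_comm _ _ _ _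
  by_contra! hcon
  have hzero : ∀ w : W, ∑ a : A, ((χ ⟨a, 0⟩ * ψ (β w a) : Rˣ) : R) = 0 := by
    intro w
    obtain ⟨a, ha, hne⟩ := hcon w
    exact sum_eq_zero_of_ne_one (fun a : A => χ ⟨a, 0⟩ * ψ (β w a)) (hadd w) (g := ⟨a, ha⟩) hne
  have hsum : ∀ a : A, a ≠ 0 → ∑ w : W, ((χ ⟨a, 0⟩ * ψ (β w a) : Rˣ) : R) = 0 := by
    intro a ha
    obtain ⟨u, hu⟩ : ∃ u, β u a ≠ 0 := by
      by_contra! h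
      refine ha (Subtype.ext (hnd a fun u => ?_))
      rw [form_swap halt, h, neg_zero]
    obtain ⟨x, hx⟩ := hψnt
    simp only [Units.val_mul, ← Finset.mul_sum]
    rw [sum_eq_zero_of_ne_one (fun w : W => ψ (β w a))
      (fun x y => by rw [map_add, LinearMap.add_apply, hψ]) (g := (x / β u a) • u), mul_zero]
    rwa [map_smul, LinearMap.smul_apply, smul_eq_mul, div_mul_cancel₀ _ hu]
  have htotal : ∑ a : A, ∑ w : W, ((χ ⟨a, 0⟩ * ψ (β w a) : Rˣ) : R) = 0 := by
    rw [Finset.sum_comm]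
    exact Finset.sum_eq_zero fun w _ => hzero w
  rw [Finset.sum_eq_single 0 (fun a _ ha => hsum a ha) (by simp)] at htotal
  refine hcard ?_
  simpa [hχext, hψ0] using htotal

/-- The characters `ψ^ℬ` and `ψ_A^ℬ` form a Heisenberg datum. -/
lemma exists_isHeisenbergDatum {p : ℕ+} [Fact (Nat.Prime (p : ℕ))] (hp2 : (p : ℕ) ≠ 2)
    [Fintype F] [CharP F (p : ℕ)] [FiniteDimensional F W]
    {β : W →ₗ[F] W →ₗ[F] F} (halt : ∀ v : W, β v v = 0)
    (hnd : ∀ v : W, (∀ u : W, β v u = 0) → v = 0)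
    (ℬ : Type*) [CommRing ℬ] [Algebra (AA p) ℬ]
    {ψ : F → (AA p)ˣ} (hψ : ∀ x y : F, ψ (x + y) = ψ x * ψ y)
    (hψnt : ∃ x : F, ψ x ≠ 1) {A : AddSubgroup W} [Fintype A]
    (hA : ∀ v : W, (∀ a ∈ A, ψ (β v a) = 1) ↔ v ∈ A) {ψA : Heis β → (AA p)ˣ}
    (hψA : ∀ a b : Heis β, a.w ∈ A → b.w ∈ A → ψA (a * b) = ψA a * ψA b)
    (hψAext : ∀ t : F, ψA ⟨0, t⟩ = ψ t) :
    ∃ w₀, IsHeisenbergDatum β ℬ A (psB p ℬ ψ) (chB p ℬ ψA) w₀ := by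
  have : IsDomain (AA p) := isDomain_AA p
  have : Finite W := Module.finite_of_finite F
  have hp : (p : ℕ).Prime := Fact.out
  have h2 : (2 : F) ≠ 0 := by
    have h := CharP.cast_eq_zero_iff F (p : ℕ) 2
    rw [Nat.cast_ofNat] at h
    exact fun h0 => hp2 ((Nat.prime_dvd_prime_iff_eq hp Nat.prime_two).1 (h.1 h0))
  have hhalf : ∀ a ∈ A, (2⁻¹ : F) • a ∈ A := by
    intro a ha
    obtain ⟨k, hk⟩ := hp.odd_of_ne_two hp2
    have e : (2⁻¹ : F) = ((k + 1 : ℕ) : F) := by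
      have h0 : ((2 * k + 1 : ℕ) : F) = 0 := hk ▸ CharP.cast_eq_zero F (p : ℕ)
      refine inv_eq_of_mul_eq_one_right ?_
      push_cast at h0 ⊢
      linear_combination h0
    rw [e, Nat.cast_smul_eq_nsmul]
    exact A.nsmul_mem ha _
  obtain ⟨n, -, hn⟩ := FiniteField.card F (p : ℕ)
  have hcardW : Nat.card W = (p : ℕ) ^ ((n : ℕ) * Module.finrank F W) := by
    rw [Module.natCard_eq_pow_finrank (K := F), Nat.card_eq_fintype_card, hn, pow_mul]
  have hunit : ∀ m : ℕ, IsUnit ((p ^ m : ℕ) : AA p) := fun m => by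
    rw [Nat.cast_pow]
    exact (isUnit_natCast_AA p).pow m
  have hunit' : ∀ m : ℕ, IsUnit ((p ^ m : ℕ) : ℬ) := fun m => by
    simpa using (hunit m).map (algebraMap (AA p) ℬ)
  obtain ⟨w₀, hw₀⟩ := exists_shift halt hnd hψ hψnt (hcardW ▸ (hunit _).ne_zero) hA hhalf hψA
    hψAext
  refine ⟨w₀, ⟨halt, h2, fun x y => ?_, fun c hc => ?_, hn ▸ hunit' n, hhalf,
    fun v hv a ha => ?_, fun v hv => ?_, ?_, fun a b ha hb => ?_, fun t => ?_, fun a ha => ?_⟩⟩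
  · rw [psB, hψ, map_mul]
    rfl
  · simpa [psB] using congrArg (algebraMap (AA p) ℬ) (sum_mul_eq_zero hψ hψnt hc)
  · rw [psB, (hA v).2 hv a ha, map_one]
  · obtain ⟨a, ha, hne⟩ : ∃ a ∈ A, ψ (β v a) ≠ 1 := by
      by_contra! h
      exact hv ((hA v).1 h)
    have h := sum_eq_zero_of_ne_one (fun a : A => ψ (β v a))
      (fun x y => by rw [AddSubgroup.coe_add, map_add, hψ]) (g := ⟨a, ha⟩) hne
    simpa [psB] using congrArg (algebraMap (AA p) ℬ) h
  · have hdvd : Fintype.card A ∣ Nat.card W := by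
      rw [← Nat.card_eq_fintype_card]
      exact A.card_addSubgroup_dvd_card
    rw [hcardW] at hdvd
    exact isUnit_of_dvd_unit (Nat.cast_dvd_cast hdvd) (hunit' _)
  · rw [chB, hψA a b ha hb, map_mul]
    rfl
  · rw [chB, hψAext]
    rfl
  · rw [chB, psB, ← map_mul, hw₀ a ha, map_one]

/-- Except in the exceptional case `q = 3`, `dim W = 2`, the first
projection restricts to an isomorphism from the commutator subgroup
`[S̃p_A^ℬ(W), S̃p_A^ℬ(W)]` onto `Sp(W)`. -/
theorem statement_10
    (p : ℕ+) [Fact (Nat.Prime (p : ℕ))] (hp2 : (p : ℕ) ≠ 2)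
    {F : Type*} [Field F] [Fintype F] [CharP F (p : ℕ)]
    {W : Type*} [AddCommGroup W] [Module F W] [FiniteDimensional F W]
    (β : W →ₗ[F] W →ₗ[F] F)
    (halt : ∀ v : W, β v v = 0)
    (hnd : ∀ v : W, (∀ u : W, β v u = 0) → v = 0)
    (ℬ : Type*) [CommRing ℬ] [Algebra (AA p) ℬ]
    (ψ : F → (AA p)ˣ) (hψ : ∀ x y : F, ψ (x + y) = ψ x * ψ y)
    (hψnt : ∃ x : F, ψ x ≠ 1)
    (A : AddSubgroup W)
    (hA : ∀ v : W, (∀ a ∈ A, ψ (β v a) = 1) ↔ v ∈ A)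
    (ψA : Heis β → (AA p)ˣ)
    (hψA : ∀ a b : Heis β, a.w ∈ A → b.w ∈ A → ψA (a * b) = ψA a * ψA b)
    (hψAext : ∀ t : F, ψA ⟨0, t⟩ = ψ t)
    (hexc : ¬(Fintype.card F = 3 ∧ Module.finrank F W = 2)) :
    Set.BijOn (fun x => x.1)
      (↑⁅MetaGrp p β ℬ A ψA, MetaGrp p β ℬ A ψA⁆ :
        Set ((W ≃ₗ[F] W) ×
          (↥(IndV β ℬ A (chB p ℬ ψA)) ≃ₗ[ℬ] ↥(IndV β ℬ A (chB p ℬ ψA)))))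
      (↑(SpGrp β) : Set (W ≃ₗ[F] W)) := by
  have : Finite W := Module.finite_of_finite F
  have : Fintype A := Fintype.ofFinite A
  obtain ⟨w₀, D⟩ := exists_isHeisenbergDatum hp2 halt hnd ℬ hψ hψnt hA hψA hψAext
  exact bijOn_commutator D hnd hexc
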